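/- arXiv:1112.2318 — 4 statements merged into one kernel-verified Lean document; each statement's English description precedes it below -/
import Mathlib

section
/- Let f : ℝ^{n×m} → ℝ be differentiable, λ > 0, and let φ(U,B,V) = f(U B Vᵀ) + λ·Trace(B). Suppose the triple (U,B,V), with U ∈ ℝ^{n×p} satisfying Uᵀ U = I_p, V ∈ ℝ^{m×p} satisfying Vᵀ V = I_p, and B ∈ ℝ^{p×p} symmetric positive definite, is a local minimum of φ over the set of all such triples. Then, with S = ∇f(U B Vᵀ) (the Euclidean gradient of f at U B Vᵀ), the following three matrix equations hold: S V B − U·Sym(Uᵀ S V B) = 0, Sym(Uᵀ S V) + λ I_p = 0, and Sᵀ U B − V·Sym(Vᵀ Sᵀ U B) = 0. -/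
open Matrix

noncomputable def symPart {p : ℕ} (Δ : Matrix (Fin p) (Fin p) ℝ) : Matrix (Fin p) (Fin p) ℝ :=
  (1 / 2 : ℝ) • (Δ + Δᵀ)

attribute [local instance] Matrix.normedAddCommGroup Matrix.normedSpace

theorem IsLocalMinOn.fderiv_apply_eq_zero_of_hasDerivAt {E : Type*} [NormedAddCommGroup E]
    [NormedSpace ℝ E] {g : E → ℝ} {s : Set E} {x v : E} {γ : ℝ → E} {g' : E →L[ℝ] ℝ}
    (hg : IsLocalMinOn g s x) (hg' : HasFDerivAt g g' x) (h0 : γ 0 = x)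
    (hγ : HasDerivAt γ v 0) (hs : ∀ᶠ t in nhds 0, γ t ∈ s) : g' v = 0 := by
  subst h0
  have hmin : IsLocalMin (g ∘ γ) 0 :=
    IsMinFilter.comp_tendsto (f := g) hg (tendsto_nhdsWithin_iff.2 ⟨hγ.continuousAt, hs⟩)
  exact hmin.hasDerivAt_eq_zero (hg'.comp_hasDerivAt 0 hγ)

/-- The Givens rotation `1 + sin t • K + (1 - cos t) • K²` generated by a skew-symmetric `K`
with `K³ = -K`. -/
noncomputable def givensRotation {n : ℕ} (K : Matrix (Fin n) (Fin n) ℝ) (t : ℝ) :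
    Matrix (Fin n) (Fin n) ℝ :=
  1 + Real.sin t • K + (1 - Real.cos t) • (K * K)

theorem givensRotation_transpose_mul_self {n : ℕ} {K : Matrix (Fin n) (Fin n) ℝ}
    (hK : Kᵀ = -K) (hK3 : K * K * K = -K) (t : ℝ) :
    (givensRotation K t)ᵀ * givensRotation K t = 1 := by
  have hK4 : K * K * (K * K) = -(K * K) := by rw [← mul_assoc, hK3, neg_mul]
  have hK3' : K * (K * K) = -K := by rw [← mul_assoc, hK3]
  simp only [givensRotation, transpose_add, transpose_smul, transpose_mul, transpose_one, hK,
    add_mul, mul_add, smul_mul_assoc, mul_smul_comm, one_mul, mul_one, neg_mul,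
    mul_neg, hK3, hK3', hK4, smul_neg, neg_neg]
  have h := Real.sin_sq_add_cos_sq t
  match_scalars
  · ring
  · ring
  · linear_combination -h

theorem hasDerivAt_givensRotation_mul {n p : ℕ} (K : Matrix (Fin n) (Fin n) ℝ)
    (W : Matrix (Fin n) (Fin p) ℝ) :
    HasDerivAt (fun t => givensRotation K t * W) (K * W) 0 := by
  have h1 := (Real.hasDerivAt_sin 0).smul_const (K * W)
  have h2 := ((Real.hasDerivAt_cos 0).const_sub 1).smul_const (K * K * W)
  have h := (h1.const_add W).add h2
  simp only [Real.cos_zero, Real.sin_zero, neg_zero, zero_smul, one_smul, add_zero] at h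
  refine h.congr_of_eventuallyEq (Filter.Eventually.of_forall fun t => ?_)
  simp [givensRotation, Matrix.add_mul]

theorem mul_transpose_isSymm_of_isLocalMinOn {n p : ℕ} {g : Matrix (Fin n) (Fin p) ℝ → ℝ}
    {W G : Matrix (Fin n) (Fin p) ℝ} {g' : Matrix (Fin n) (Fin p) ℝ →L[ℝ] ℝ} (hW : Wᵀ * W = 1)
    (hg : IsLocalMinOn g {X | Xᵀ * X = 1} W) (hg' : HasFDerivAt g g' W)
    (hG : ∀ H, g' H = (Gᵀ * H).trace) : (W * Gᵀ).IsSymm := by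
  ext i j
  rcases eq_or_ne i j with rfl | hij
  · rfl
  let K : Matrix (Fin n) (Fin n) ℝ := single i j 1 - single j i 1
  have hK : Kᵀ = -K := by simp [K]
  have hK3 : K * K * K = -K := by
    simp [K, hij, hij.symm, sub_eq_add_neg, add_mul, mul_add, add_comm]
  have h := hg.fderiv_apply_eq_zero_of_hasDerivAt hg' (γ := fun t => givensRotation K t * W)
    (by simp [givensRotation]) (hasDerivAt_givensRotation_mul K W)
    (Filter.Eventually.of_forall fun t => by
      rw [Set.mem_ofPred_eq, transpose_mul, Matrix.mul_assoc, ← Matrix.mul_assoc _ _ W,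
        givensRotation_transpose_mul_self hK hK3, Matrix.one_mul, hW])
  replace h := (hG _).symm.trans h
  rw [← Matrix.mul_assoc, Matrix.trace_mul_comm, ← Matrix.mul_assoc] at h
  simp only [K, Matrix.mul_sub, Matrix.trace_sub, Matrix.trace_mul_single] at h
  simp at h
  rw [transpose_apply]
  linarith

theorem sub_mul_symPart_eq_zero_of_isLocalMinOn {n p : ℕ} {g : Matrix (Fin n) (Fin p) ℝ → ℝ}
    {W G : Matrix (Fin n) (Fin p) ℝ} {g' : Matrix (Fin n) (Fin p) ℝ →L[ℝ] ℝ} (hW : Wᵀ * W = 1)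
    (hg : IsLocalMinOn g {X | Xᵀ * X = 1} W) (hg' : HasFDerivAt g g' W)
    (hG : ∀ H, g' H = (Gᵀ * H).trace) : G - W * symPart (Wᵀ * G) = 0 := by
  have hsymm : G * Wᵀ = W * Gᵀ := by
    simpa [IsSymm] using mul_transpose_isSymm_of_isLocalMinOn hW hg hg' hG
  have hG_eq : G = W * (Gᵀ * W) := by
    rw [← Matrix.mul_assoc, ← hsymm, Matrix.mul_assoc, hW, Matrix.mul_one]
  have hWG : Wᵀ * G = Gᵀ * W := by
    conv_lhs => rw [hG_eq, ← Matrix.mul_assoc, hW, Matrix.one_mul]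
  have hsym : symPart (Wᵀ * G) = Gᵀ * W := by
    rw [symPart, transpose_mul, transpose_transpose, hWG]
    module
  rw [hsym, ← hG_eq, sub_self]

theorem eventually_posDef_one_add_smul_mul {p : ℕ} {B : Matrix (Fin p) (Fin p) ℝ}
    (hB : B.PosDef) (X : Matrix (Fin p) (Fin p) ℝ) :
    ∀ᶠ t : ℝ in nhds 0, ((1 + t • X) * B * (1 + t • X)ᵀ).PosDef := by
  have hc : Continuous fun t : ℝ => (1 + t • X).det := by fun_prop
  have h0 : (1 + (0 : ℝ) • X).det ≠ 0 := by simp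
  filter_upwards [hc.continuousAt.eventually_ne h0] with t ht
  exact hB.mul_mul_conjTranspose_same
    (Matrix.vecMul_injective_of_isUnit ((Matrix.isUnit_iff_isUnit_det _).2 ht.isUnit))

theorem symPart_eq_zero_of_isLocalMinOn_posDef {p : ℕ} {g : Matrix (Fin p) (Fin p) ℝ → ℝ}
    {B G : Matrix (Fin p) (Fin p) ℝ} {g' : Matrix (Fin p) (Fin p) ℝ →L[ℝ] ℝ} (hB : B.PosDef)
    (hg : IsLocalMinOn g {X | X.PosDef} B) (hg' : HasFDerivAt g g' B)
    (hG : ∀ H, g' H = (Gᵀ * H).trace) : symPart G = 0 := by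
  set M := symPart G with hM
  have hBT : Bᵀ = B := hB.isHermitian
  have hMT : Mᵀ = M := by simp [hM, symPart, add_comm]
  have hd : HasDerivAt (fun t : ℝ => (1 + t • (M * B)) * B * (1 + t • (M * B))ᵀ)
      (M * B * B + B * (B * M)) 0 := by
    have h1 := (hasDerivAt_id (0 : ℝ)).smul_const (M * B * B + B * (B * M))
    have h2 := ((hasDerivAt_id (0 : ℝ)).pow 2).smul_const (M * B * B * (B * M))
    have h := (h1.const_add B).add h2
    simp only [id, one_smul, Nat.cast_ofNat, Nat.add_one_sub_one, pow_one, mul_zero, mul_one,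
      zero_smul, add_zero] at h
    refine h.congr_of_eventuallyEq (Filter.Eventually.of_forall fun t => ?_)
    simp only [transpose_add, transpose_one, transpose_smul, transpose_mul, hBT, hMT, add_mul,
      mul_add, one_mul, mul_one, smul_mul_assoc, mul_smul_comm, Pi.add_apply, Pi.pow_apply, id]
    module
  have h := hg.fderiv_apply_eq_zero_of_hasDerivAt hg' (by simp) hd
    (eventually_posDef_one_add_smul_mul hB (M * B))
  have hfrob : ((M * B)ᵀ * (M * B)).trace = 0 := by
    have e1 : (Gᵀ * (M * B * B + B * (B * M))).trace
        = 2 * (M * (M * B * B)).trace := by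
      have e2 : (Gᵀ * (B * (B * M))).trace = (G * (M * B * B)).trace := by
        rw [← Matrix.trace_transpose]
        simp only [transpose_mul, transpose_transpose, hBT, hMT]
        rw [Matrix.trace_mul_comm]
      have e3 : M * (M * B * B) = (1 / 2 : ℝ) • (G * (M * B * B) + Gᵀ * (M * B * B)) := by
        generalize M * B * B = Y
        rw [hM, symPart, smul_mul_assoc, add_mul]
      rw [mul_add, trace_add, e2, e3, trace_smul, trace_add, smul_eq_mul]
      ring
    replace h := (hG _).symm.trans h
    rw [e1] at h
    rw [transpose_mul, hMT, hBT, Matrix.mul_assoc, Matrix.trace_mul_comm, Matrix.mul_assoc M]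
    linarith
  have hMB : M * B = 0 := by
    rw [← Matrix.conjTranspose_eq_transpose_of_trivial] at hfrob
    exact Matrix.trace_conjTranspose_mul_self_eq_zero_iff.1 hfrob
  have hu := hB.isUnit
  exact hu.mul_left_eq_zero.1 hMB

/-- First-order necessary optimality conditions for the fixed-rank factorized problem:
if `(U, B, V)` (with `UᵀU = I`, `VᵀV = I`, `B` symmetric positive definite) is a local
minimum of `φ(U,B,V) = f(UBVᵀ) + λ·Trace(B)` over the set of all such triples, then,
with `S = ∇f(UBVᵀ)`, the three matrix equations hold. -/
theorem stmt_0 {n m p : ℕ} (f : Matrix (Fin n) (Fin m) ℝ → ℝ) (hf : Differentiable ℝ f)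
    (lam : ℝ) (hlam : 0 < lam)
    (U : Matrix (Fin n) (Fin p) ℝ) (B : Matrix (Fin p) (Fin p) ℝ)
    (V : Matrix (Fin m) (Fin p) ℝ)
    (hU : Uᵀ * U = 1) (hV : Vᵀ * V = 1) (hB : B.PosDef)
    (S : Matrix (Fin n) (Fin m) ℝ)
    (hS : ∀ H : Matrix (Fin n) (Fin m) ℝ, fderiv ℝ f (U * B * Vᵀ) H = (Sᵀ * H).trace)
    (hmin : IsLocalMinOn
      (fun t : Matrix (Fin n) (Fin p) ℝ × Matrix (Fin p) (Fin p) ℝ × Matrix (Fin m) (Fin p) ℝ =>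
        f (t.1 * t.2.1 * t.2.2ᵀ) + lam * t.2.1.trace)
      {t : Matrix (Fin n) (Fin p) ℝ × Matrix (Fin p) (Fin p) ℝ × Matrix (Fin m) (Fin p) ℝ |
        t.1ᵀ * t.1 = 1 ∧ t.2.1.PosDef ∧ t.2.2ᵀ * t.2.2 = 1}
      (U, B, V)) :
    S * V * B - U * symPart (Uᵀ * S * V * B) = 0 ∧
    symPart (Uᵀ * S * V) + lam • (1 : Matrix (Fin p) (Fin p) ℝ) = 0 ∧
    Sᵀ * U * B - V * symPart (Vᵀ * Sᵀ * U * B) = 0 := by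
  have hf' := (hf (U * B * Vᵀ)).hasFDerivAt
  have hBT : Bᵀ = B := hB.isHermitian
  refine ⟨?_, ?_, ?_⟩
  · let L : Matrix (Fin n) (Fin p) ℝ →L[ℝ] Matrix (Fin n) (Fin m) ℝ :=
      (LinearMap.mk ⟨fun X => X * B * Vᵀ, by simp [Matrix.add_mul]⟩ (by simp)).toContinuousLinearMap
    have hg : IsLocalMinOn (fun X => f (L X) + lam * B.trace) {X | Xᵀ * X = 1} U :=
      IsMinFilter.comp_tendsto (g := fun X => (X, B, V)) hmin
        ((Continuous.tendsto (by fun_prop) U).inf (by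
          simpa using fun X hX => ⟨hX, hB, hV⟩))
    have hg' := ((show HasFDerivAt f _ (L U) from hf').comp U L.hasFDerivAt).add_const
      (lam * B.trace)
    have h := sub_mul_symPart_eq_zero_of_isLocalMinOn (G := S * V * B) hU hg hg' fun H => by
      refine (hS (H * B * Vᵀ)).trans ?_
      rw [← Matrix.mul_assoc, Matrix.trace_mul_comm, ← Matrix.mul_assoc, ← Matrix.mul_assoc,
        Matrix.trace_mul_comm]
      simp only [transpose_mul, hBT, Matrix.mul_assoc]
    simpa only [Matrix.mul_assoc] using h
  · let L : Matrix (Fin p) (Fin p) ℝ →L[ℝ] Matrix (Fin n) (Fin m) ℝ :=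
      (LinearMap.mk ⟨fun X => U * X * Vᵀ, by simp [Matrix.add_mul, Matrix.mul_add]⟩
        (by simp)).toContinuousLinearMap
    let T : Matrix (Fin p) (Fin p) ℝ →L[ℝ] ℝ :=
      (lam • traceLinearMap (Fin p) ℝ ℝ).toContinuousLinearMap
    have hg : IsLocalMinOn (fun X => f (L X) + T X) {X | X.PosDef} B :=
      IsMinFilter.comp_tendsto (g := fun X => (U, X, V)) hmin
        ((Continuous.tendsto (by fun_prop) B).inf (by
          simpa using fun X hX => ⟨hU, hX, hV⟩))
    have hg' := ((show HasFDerivAt f _ (L B) from hf').comp B L.hasFDerivAt).add T.hasFDerivAt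
    have h := symPart_eq_zero_of_isLocalMinOn_posDef (G := Uᵀ * S * V + lam • 1) hB hg hg'
      fun H => by
        refine (congrArg (· + lam * H.trace) (hS (U * H * Vᵀ))).trans ?_
        simp only [transpose_add, transpose_smul, transpose_one, Matrix.add_mul, smul_mul_assoc,
          Matrix.one_mul, trace_add, trace_smul, smul_eq_mul, add_left_inj]
        rw [← Matrix.mul_assoc, Matrix.trace_mul_comm]
        simp only [transpose_mul, transpose_transpose, Matrix.mul_assoc]
    rw [← h]
    simp only [symPart, transpose_add, transpose_smul, transpose_one]
    module
  · let L : Matrix (Fin m) (Fin p) ℝ →L[ℝ] Matrix (Fin n) (Fin m) ℝ :=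
      (LinearMap.mk ⟨fun X => U * B * Xᵀ, by simp [Matrix.mul_add]⟩ (by simp)).toContinuousLinearMap
    have hg : IsLocalMinOn (fun X => f (L X) + lam * B.trace) {X | Xᵀ * X = 1} V :=
      IsMinFilter.comp_tendsto (g := fun X => (U, B, X)) hmin
        ((Continuous.tendsto (by fun_prop) V).inf (by
          simpa using fun X hX => ⟨hU, hB, hX⟩))
    have hg' := ((show HasFDerivAt f _ (L V) from hf').comp V L.hasFDerivAt).add_const
      (lam * B.trace)
    have h := sub_mul_symPart_eq_zero_of_isLocalMinOn (G := Sᵀ * U * B) hV hg hg' fun H => by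
      refine (hS (U * B * Hᵀ)).trans ?_
      rw [← Matrix.trace_transpose]
      simp only [transpose_mul, transpose_transpose, hBT, Matrix.mul_assoc]
      rw [Matrix.trace_mul_comm]
      simp only [Matrix.mul_assoc]
    simpa only [Matrix.mul_assoc] using h
end

section
/- Let λ ≥ 0, S ∈ ℝ^{n×m}, U ∈ ℝ^{n×p} with Uᵀ U = I_p, and V ∈ ℝ^{m×p} with Vᵀ V = I_p. If Sym(Uᵀ S V) + λ I_p = 0, then λ ≤ ‖S‖_op. -/
open Matrix

/-- The operator norm (largest singular value) of a matrix, as the operator norm of the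
induced linear map between Euclidean spaces. -/
noncomputable def opNorm {n m : ℕ} (X : Matrix (Fin n) (Fin m) ℝ) : ℝ :=
  ‖LinearMap.toContinuousLinearMap (Matrix.toEuclideanLin X)‖

/-- A column of a matrix with orthonormal columns is a unit vector. -/
theorem norm_toLp_col_eq_one {n p : ℕ} (U : Matrix (Fin n) (Fin p) ℝ) (hU : Uᵀ * U = 1)
    (i : Fin p) : ‖WithLp.toLp 2 (U.col i)‖ = 1 := by
  have hii := congrFun (congrFun hU i) i
  simp only [Matrix.mul_apply, Matrix.transpose_apply, Matrix.one_apply_eq] at hii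
  simp [EuclideanSpace.norm_eq, Matrix.col_apply, sq, hii]

/-- If `U` and `V` have orthonormal columns, the diagonal entries of `Uᵀ S V` are bounded by the
operator norm of `S`. -/
theorem abs_transpose_mul_mul_apply_le_opNorm {n m p : ℕ} (S : Matrix (Fin n) (Fin m) ℝ)
    (U : Matrix (Fin n) (Fin p) ℝ) (V : Matrix (Fin m) (Fin p) ℝ)
    (hU : Uᵀ * U = 1) (hV : Vᵀ * V = 1) (i : Fin p) :
    |(Uᵀ * S * V) i i| ≤ opNorm S := by
  set u : EuclideanSpace ℝ (Fin n) := WithLp.toLp 2 (U.col i) with hu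
  set v : EuclideanSpace ℝ (Fin m) := WithLp.toLp 2 (V.col i) with hv
  set T := LinearMap.toContinuousLinearMap (Matrix.toEuclideanLin S) with hT
  have hentry : (Uᵀ * S * V) i i = inner ℝ u (T v) := by
    rw [Matrix.mul_assoc]
    simp [hu, hv, hT, Matrix.mul_apply, PiLp.inner_apply, Matrix.toLpLin_apply,
      Matrix.mulVec, dotProduct, mul_comm]
  calc |(Uᵀ * S * V) i i| = |inner ℝ u (T v)| := by rw [hentry]
    _ ≤ ‖u‖ * ‖T v‖ := abs_real_inner_le_norm u (T v)
    _ = ‖T v‖ := by rw [norm_toLp_col_eq_one U hU i, one_mul]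
    _ ≤ ‖T‖ * ‖v‖ := T.le_opNorm v
    _ = opNorm S := by rw [norm_toLp_col_eq_one V hV i, mul_one, opNorm]

/-- If `Sym(Uᵀ S V) + λ I = 0` with `U, V` having orthonormal columns, then `λ ≤ ‖S‖_op`. -/
theorem stmt_3 {n m p : ℕ} (hp : 0 < p) (lam : ℝ) (hlam : 0 ≤ lam)
    (S : Matrix (Fin n) (Fin m) ℝ)
    (U : Matrix (Fin n) (Fin p) ℝ) (V : Matrix (Fin m) (Fin p) ℝ)
    (hU : Uᵀ * U = 1) (hV : Vᵀ * V = 1)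
    (h : symPart (Uᵀ * S * V) + lam • (1 : Matrix (Fin p) (Fin p) ℝ) = 0) :
    lam ≤ opNorm S := by
  have hdiag := congrFun (congrFun h ⟨0, hp⟩) ⟨0, hp⟩
  simp only [symPart, Matrix.add_apply, Matrix.smul_apply, Matrix.transpose_apply,
    Matrix.one_apply_eq, Matrix.zero_apply, smul_eq_mul, mul_one] at hdiag
  have hbound := abs_transpose_mul_mul_apply_le_opNorm S U V hU hV ⟨0, hp⟩
  linarith [neg_abs_le ((Uᵀ * S * V) ⟨0, hp⟩ ⟨0, hp⟩)]
end

section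
/- Let U ∈ ℝ^{n×p} with Uᵀ U = I_p, V ∈ ℝ^{m×p} with Vᵀ V = I_p, and B ∈ ℝ^{p×p} symmetric positive definite. Define the inner product ḡ((ξ_U,ξ_B,ξ_V),(η_U,η_B,η_V)) = Trace(ξ_Uᵀ η_U) + Trace(B⁻¹ ξ_B B⁻¹ η_B) + Trace(ξ_Vᵀ η_V) on triples in ℝ^{n×p} × ℝ^{p×p} × ℝ^{m×p}. Let ζ = (ζ_U, ζ_B, ζ_V) with Uᵀζ_U skew-symmetric, ζ_B symmetric, and Vᵀζ_V skew-symmetric. Then ḡ(ζ, (UΩ, BΩ − ΩB, VΩ)) = 0 for every skew-symmetric Ω ∈ ℝ^{p×p} if and only if the matrix ζ_Uᵀ U + B⁻¹ ζ_B − ζ_B B⁻¹ + ζ_Vᵀ V is symmetric. -/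
open Matrix

/-- A real square matrix is trace-orthogonal to all skew-symmetric matrices iff it is symmetric. -/
theorem forall_trace_mul_skew_eq_zero_iff {ι : Type*} [Fintype ι] (M : Matrix ι ι ℝ) :
    (∀ Ω : Matrix ι ι ℝ, Ωᵀ = -Ω → (M * Ω).trace = 0) ↔ Mᵀ = M := by
  have htr : ∀ Ω : Matrix ι ι ℝ, Ωᵀ = -Ω → (Mᵀ * Ω).trace = -(M * Ω).trace := by
    intro Ω hΩ
    rw [← trace_transpose, transpose_mul, transpose_transpose, hΩ, Matrix.neg_mul, trace_neg,
      trace_mul_comm]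
  constructor
  · intro h
    have hskew : (Mᵀ - M)ᵀ = -(Mᵀ - M) := by
      rw [transpose_sub, transpose_transpose, neg_sub]
    have h₀ : ((Mᵀ - M)ᴴ * (Mᵀ - M)).trace = 0 := by
      rw [conjTranspose_eq_transpose_of_trivial, hskew, Matrix.neg_mul, Matrix.sub_mul, trace_neg,
        trace_sub, htr _ hskew, h _ hskew]
      simp
    exact sub_eq_zero.mp (trace_conjTranspose_mul_self_eq_zero_iff.mp h₀)
  · intro hM Ω hΩ
    have h := htr Ω hΩ
    rw [hM] at h
    linarith

/-- Characterization of the horizontal space: for `U, V` with orthonormal columns and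
`B` symmetric positive definite, a tangent triple `(ζ_U, ζ_B, ζ_V)` (with `Uᵀζ_U`,
`Vᵀζ_V` skew-symmetric and `ζ_B` symmetric) is `ḡ`-orthogonal to every vertical triple
`(UΩ, BΩ − ΩB, VΩ)` (`Ω` skew-symmetric) iff
`ζ_Uᵀ U + B⁻¹ ζ_B − ζ_B B⁻¹ + ζ_Vᵀ V` is symmetric. -/
theorem stmt_14 {n m p : ℕ}
    (U : Matrix (Fin n) (Fin p) ℝ) (V : Matrix (Fin m) (Fin p) ℝ)
    (B : Matrix (Fin p) (Fin p) ℝ)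
    (hU : Uᵀ * U = 1) (hV : Vᵀ * V = 1) (hB : B.PosDef)
    (ζU : Matrix (Fin n) (Fin p) ℝ) (ζB : Matrix (Fin p) (Fin p) ℝ)
    (ζV : Matrix (Fin m) (Fin p) ℝ)
    (hζU : (Uᵀ * ζU)ᵀ = -(Uᵀ * ζU)) (hζB : ζBᵀ = ζB) (hζV : (Vᵀ * ζV)ᵀ = -(Vᵀ * ζV)) :
    (∀ Ω : Matrix (Fin p) (Fin p) ℝ, Ωᵀ = -Ω →
      (ζUᵀ * (U * Ω)).trace + (B⁻¹ * ζB * B⁻¹ * (B * Ω - Ω * B)).trace +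
        (ζVᵀ * (V * Ω)).trace = 0) ↔
    (ζUᵀ * U + B⁻¹ * ζB - ζB * B⁻¹ + ζVᵀ * V)ᵀ =
      ζUᵀ * U + B⁻¹ * ζB - ζB * B⁻¹ + ζVᵀ * V := by
  have hdet : IsUnit B.det := hB.det_pos.ne'.isUnit
  have key : ∀ Ω : Matrix (Fin p) (Fin p) ℝ,
      (ζUᵀ * (U * Ω)).trace + (B⁻¹ * ζB * B⁻¹ * (B * Ω - Ω * B)).trace +
        (ζVᵀ * (V * Ω)).trace =
      ((ζUᵀ * U + B⁻¹ * ζB - ζB * B⁻¹ + ζVᵀ * V) * Ω).trace := by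
    intro Ω
    have h₁ : B⁻¹ * ζB * B⁻¹ * (B * Ω) = B⁻¹ * ζB * Ω := by
      rw [Matrix.mul_assoc _ B⁻¹, nonsing_inv_mul_cancel_left _ _ hdet]
    have h₂ : (B⁻¹ * ζB * B⁻¹ * (Ω * B)).trace = (ζB * B⁻¹ * Ω).trace := by
      rw [← Matrix.mul_assoc, trace_mul_comm, Matrix.mul_assoc B⁻¹, Matrix.mul_assoc B⁻¹,
        mul_nonsing_inv_cancel_left _ _ hdet]
    rw [Matrix.mul_sub, trace_sub, h₁, h₂]
    simp only [Matrix.add_mul, Matrix.sub_mul, trace_add, trace_sub, Matrix.mul_assoc]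
    ring
  simp only [key]
  exact forall_trace_mul_skew_eq_zero_iff _
end

section
/- Let U ∈ ℝ^{n×p} with Uᵀ U = I_p, V ∈ ℝ^{m×p} with Vᵀ V = I_p, and B ∈ ℝ^{p×p} symmetric positive definite. Define the inner product ḡ((ξ_U,ξ_B,ξ_V),(η_U,η_B,η_V)) = Trace(ξ_Uᵀ η_U) + Trace(B⁻¹ ξ_B B⁻¹ η_B) + Trace(ξ_Vᵀ η_V) on triples in ℝ^{n×p} × ℝ^{p×p} × ℝ^{m×p}. Let (η_U, η_B, η_V) be a triple with Uᵀη_U skew-symmetric, η_B symmetric, and Vᵀη_V skew-symmetric, and let Ω ∈ ℝ^{p×p} be the (unique) solution of the Lyapunov equation Ω B² + B² Ω = B·(Skew(Uᵀ η_U) − 2·Skew(B⁻¹ η_B) + Skew(Vᵀ η_V))·B. Then the projected triple (η_U − UΩ, η_B − (BΩ − ΩB), η_V − VΩ) is ḡ-orthogonal to every vertical triple: ḡ((η_U − UΩ, η_B − (BΩ − ΩB), η_V − VΩ), (UΩ', BΩ' − Ω'B, VΩ')) = 0 for every skew-symmetric Ω' ∈ ℝ^{p×p}. -/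
open Matrix

noncomputable def skewPart {p : ℕ} (Δ : Matrix (Fin p) (Fin p) ℝ) :
    Matrix (Fin p) (Fin p) ℝ :=
  (1 / 2 : ℝ) • (Δ - Δᵀ)

/-- The trace of the product of a symmetrized matrix with a skew-symmetric matrix vanishes. -/
theorem trace_add_transpose_mul_of_transpose_eq_neg {p : ℕ} (M W : Matrix (Fin p) (Fin p) ℝ)
    (hW : Wᵀ = -W) : ((M + Mᵀ) * W).trace = 0 := by
  have h : (Mᵀ * W).trace = -(M * W).trace := by
    rw [← trace_transpose, transpose_mul, transpose_transpose, hW, neg_mul, trace_neg,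
      trace_mul_comm]
  rw [add_mul, trace_add, h, add_neg_cancel]

/-- For `Q` with orthonormal columns and `Qᵀ * η` skew-symmetric, the pairing of `η - Q * Ω`
with `Q * W` only involves `p × p` matrices. -/
theorem transpose_sub_mul_mul_of_orthonormal {n p : ℕ} (Q η : Matrix (Fin n) (Fin p) ℝ)
    (hQ : Qᵀ * Q = 1) (hη : (Qᵀ * η)ᵀ = -(Qᵀ * η)) (Ω W : Matrix (Fin p) (Fin p) ℝ) :
    (η - Q * Ω)ᵀ * (Q * W) = (-(Qᵀ * η) - Ωᵀ) * W := by
  rw [transpose_mul, transpose_transpose] at hη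
  rw [← Matrix.mul_assoc, transpose_sub, transpose_mul, Matrix.sub_mul ηᵀ, Matrix.mul_assoc Ωᵀ, hQ, hη,
    Matrix.mul_one]

/-- The metric `Trace(B⁻¹ X B⁻¹ Y)` against `Y = B * W - W * B`. -/
theorem trace_inv_mul_inv_mul_commutator {p : ℕ} {B : Matrix (Fin p) (Fin p) ℝ}
    (hB : IsUnit B.det) (X W : Matrix (Fin p) (Fin p) ℝ) :
    (B⁻¹ * X * B⁻¹ * (B * W - W * B)).trace = ((B⁻¹ * X - X * B⁻¹) * W).trace := by
  have h₁ : B⁻¹ * X * B⁻¹ * (B * W) = B⁻¹ * X * W := by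
    rw [← Matrix.mul_assoc, Matrix.mul_assoc (B⁻¹ * X), nonsing_inv_mul B hB, Matrix.mul_one]
  have h₂ : (B⁻¹ * X * B⁻¹ * (W * B)).trace = (X * B⁻¹ * W).trace := by
    rw [← Matrix.mul_assoc, trace_mul_comm, Matrix.mul_assoc B⁻¹, Matrix.mul_assoc B⁻¹,
      ← Matrix.mul_assoc B, mul_nonsing_inv B hB, Matrix.one_mul]
  rw [mul_sub, sub_mul, trace_sub, trace_sub, h₁, h₂]

theorem skewPart_of_transpose_eq_neg {p : ℕ} {A : Matrix (Fin p) (Fin p) ℝ} (hA : Aᵀ = -A) :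
    skewPart A = A := by
  rw [skewPart, hA]
  module

/-- Projection onto the horizontal space: if `Ω` solves the Lyapunov equation
`Ω B² + B² Ω = B (Skew(Uᵀη_U) − 2 Skew(B⁻¹η_B) + Skew(Vᵀη_V)) B`, then the projected
triple `(η_U − UΩ, η_B − (BΩ − ΩB), η_V − VΩ)` is `ḡ`-orthogonal to every vertical
triple `(UΩ', BΩ' − Ω'B, VΩ')` with `Ω'` skew-symmetric. -/
theorem stmt_15 {n m p : ℕ}
    (U : Matrix (Fin n) (Fin p) ℝ) (V : Matrix (Fin m) (Fin p) ℝ)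
    (B : Matrix (Fin p) (Fin p) ℝ)
    (hU : Uᵀ * U = 1) (hV : Vᵀ * V = 1) (hB : B.PosDef)
    (ηU : Matrix (Fin n) (Fin p) ℝ) (ηB : Matrix (Fin p) (Fin p) ℝ)
    (ηV : Matrix (Fin m) (Fin p) ℝ)
    (hηU : (Uᵀ * ηU)ᵀ = -(Uᵀ * ηU)) (hηB : ηBᵀ = ηB) (hηV : (Vᵀ * ηV)ᵀ = -(Vᵀ * ηV))
    (Ω : Matrix (Fin p) (Fin p) ℝ)
    (hΩ : Ω * (B * B) + (B * B) * Ω =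
      B * (skewPart (Uᵀ * ηU) - (2 : ℝ) • skewPart (B⁻¹ * ηB) + skewPart (Vᵀ * ηV)) * B) :
    ∀ Ω' : Matrix (Fin p) (Fin p) ℝ, Ω'ᵀ = -Ω' →
      ((ηU - U * Ω)ᵀ * (U * Ω')).trace +
        (B⁻¹ * (ηB - (B * Ω - Ω * B)) * B⁻¹ * (B * Ω' - Ω' * B)).trace +
        ((ηV - V * Ω)ᵀ * (V * Ω')).trace = 0 := by
  intro W hW
  have hdet : IsUnit B.det := hB.det_pos.ne'.isUnit
  have hBt : Bᵀ = B := by simpa using hB.isHermitian.eq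
  have hskew : (2 : ℝ) • skewPart (B⁻¹ * ηB) = B⁻¹ * ηB - ηB * B⁻¹ := by
    rw [skewPart, transpose_mul, transpose_nonsing_inv, hBt, hηB]
    module
  rw [skewPart_of_transpose_eq_neg hηU, skewPart_of_transpose_eq_neg hηV, hskew] at hΩ
  have hinv := nonsing_inv_mul B hdet
  have hinv' := mul_nonsing_inv B hdet
  have hlyap : B⁻¹ * Ω * B + B * Ω * B⁻¹ =
      Uᵀ * ηU - (B⁻¹ * ηB - ηB * B⁻¹) + Vᵀ * ηV := by
    have h := congrArg (fun M => B⁻¹ * M * B⁻¹) hΩ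
    have hl : B⁻¹ * (Ω * (B * B) + B * B * Ω) * B⁻¹ =
        B⁻¹ * Ω * B * (B * B⁻¹) + (B⁻¹ * B) * B * Ω * B⁻¹ := by noncomm_ring
    have hr (S : Matrix (Fin p) (Fin p) ℝ) :
        B⁻¹ * (B * S * B) * B⁻¹ = (B⁻¹ * B) * S * (B * B⁻¹) := by noncomm_ring
    simpa only [hl, hr, hinv, hinv', Matrix.one_mul, Matrix.mul_one] using h
  have hcomm : B⁻¹ * (ηB - (B * Ω - Ω * B)) - (ηB - (B * Ω - Ω * B)) * B⁻¹ =
      Uᵀ * ηU + Vᵀ * ηV - Ω - Ω := by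
    have h : B⁻¹ * (ηB - (B * Ω - Ω * B)) - (ηB - (B * Ω - Ω * B)) * B⁻¹ =
        (B⁻¹ * ηB - ηB * B⁻¹) + (B⁻¹ * Ω * B + B * Ω * B⁻¹)
          - (B⁻¹ * B) * Ω - Ω * (B * B⁻¹) := by noncomm_ring
    rw [h, hlyap, hinv, hinv', Matrix.one_mul, Matrix.mul_one]
    abel
  rw [transpose_sub_mul_mul_of_orthonormal U ηU hU hηU,
    transpose_sub_mul_mul_of_orthonormal V ηV hV hηV,
    trace_inv_mul_inv_mul_commutator hdet, hcomm, ← trace_add, ← trace_add, ← add_mul, ← add_mul]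
  have hsum : -(Uᵀ * ηU) - Ωᵀ + (Uᵀ * ηU + Vᵀ * ηV - Ω - Ω) + (-(Vᵀ * ηV) - Ωᵀ) =
      -((Ω + Ωᵀ) + (Ω + Ωᵀ)) := by abel
  rw [hsum, neg_mul, trace_neg, add_mul, trace_add,
    trace_add_transpose_mul_of_transpose_eq_neg Ω W hW, add_zero, neg_zero]
end
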